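/- Let G be a finite tree, let p ≥ q ≥ 2 and d ≥ 1 be integers, and let H be a finite family of nonempty subsets of the vertex set of G, each inducing a subgraph of G with at most d connected components, with |H| ≥ p. If H satisfies the (p,q) property, then the fractional covering number satisfies τ*(H) ≤ max{ (2^{1/(q-1)} · (e·p)^{q/(q-1)} / q) · d^{1/(q-1)} + 1 , 2·p² }. -/

import Mathlib

/-- A finite family `H` of vertex sets satisfies the `(p,q)` property if among
every `p` distinct members of `H` some `q` have a vertex in common. -/
def VertexPQProperty {V : Type*} (H : Finset (Set V)) (p q : ℕ) : Prop :=
  ∀ S ⊆ H, S.card = p → ∃ T ⊆ S, T.card = q ∧ (⋂ h ∈ T, (h : Set V)).Nonempty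

/-- The covering number `τ(H)`: the minimum cardinality of a set of vertices
meeting every member of `H`. -/
noncomputable def vertexCoverNum {V : Type*} (H : Finset (Set V)) : ℕ :=
  sInf { n : ℕ | ∃ C : Finset V, C.card = n ∧ ∀ h ∈ H, ∃ v ∈ C, v ∈ h }

/-- The fractional covering number `τ*(H)`: the infimum of total weights of
fractional covers of `H`. -/
noncomputable def vertexFracCoverNum {V : Type*} [Fintype V] (H : Finset (Set V)) : ℝ :=
  sInf { t : ℝ | ∃ w : V → ℝ, (∀ v, 0 ≤ w v) ∧
    (∀ h ∈ H, 1 ≤ ∑ v, Set.indicator h w v) ∧ t = ∑ v, w v }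

namespace SimpleGraph

variable {V : Type*} {G : SimpleGraph V}

/-- In a tree rooted at `r`, a vertex has at most one neighbour closer to `r`. -/
lemma IsTree.eq_of_adj_of_dist_lt (hG : G.IsTree) {r u v w : V} (huw : G.Adj u w)
    (hvw : G.Adj v w) (hu : G.dist r u < G.dist r w) (hv : G.dist r v < G.dist r w) : u = v := by
  obtain ⟨P, hP, -⟩ := hG.connected.exists_path_of_dist r w
  have key : ∀ x, G.Adj x w → G.dist r x < G.dist r w → x = P.penultimate := by
    intro x hx hlt
    refine hG.isAcyclic.eq_penultimate_of_adj_end hP hx.symm ?_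
    obtain ⟨Q, hQ, hQl⟩ := hG.connected.exists_path_of_dist r x
    have hR : (Q.concat hx).IsPath := by
      refine Walk.isPath_of_length_eq_dist _ ?_
      have h1 := G.dist_le (Q.concat hx)
      rw [Walk.length_concat] at *
      omega
    have : P = Q.concat hx := (hG.existsUnique_path r w).unique hP hR
    rw [this]
    simp
  rw [key u huw hu, key v hvw hv]

/-- The vertices of `s` none of whose neighbours in `s` is closer to `r`. In a tree these are the
vertices closest to `r` in the components of `s`. -/
def topVertices (G : SimpleGraph V) (r : V) (s : Set V) : Set V :=
  {v | v ∈ s ∧ ∀ u ∈ s, G.Adj u v → G.dist r v ≤ G.dist r u}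

lemma IsTree.dist_eq_of_reachable_topVertices (hG : G.IsTree) {r : V} {s : Set V} {v w : s}
    (hv : (v : V) ∈ G.topVertices r s) (h : (G.induce s).Reachable v w) :
    G.dist r w = G.dist r v + G.dist v w := by
  rw [reachable_iff_reflTransGen] at h
  induction h with
  | refl => simp
  | @tail b c _ hbc ih =>
    have hadj : G.Adj (b : V) c := hbc
    rcases hG.dist_eq_dist_add_one_of_adj r hadj with hlt | hlt
    · have hne : (v : V) ≠ b := by
        intro hvb
        have := hv.2 c c.2 (by rw [hvb]; exact hadj.symm)
        rw [hvb] at this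
        omega
      obtain ⟨P, hP⟩ := hG.connected.exists_walk_length_eq_dist (v : V) b
      have hnil : ¬ P.Nil := P.not_nil_of_ne hne
      have hpa := P.adj_penultimate hnil
      have h1 := G.dist_le P.dropLast
      have h2 : P.dropLast.length + 1 = P.length := by simpa using P.length_dropLast_add_one hnil
      have h3 := hG.connected.dist_triangle (u := r) (v := (v : V)) (w := P.penultimate)
      have h4 : P.penultimate = c :=
        hG.eq_of_adj_of_dist_lt (r := r) hpa hadj.symm (by omega) (by omega)
      have h5 : G.dist (v : V) P.penultimate = G.dist (v : V) c := by rw [h4]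
      rw [h4] at h3
      omega
    · have h1 := hG.connected.dist_triangle (u := (v : V)) (v := (b : V)) (w := c)
      rw [dist_eq_one_iff_adj.2 hadj] at h1
      have h2 := hG.connected.dist_triangle (u := r) (v := (v : V)) (w := c)
      omega

lemma IsTree.ncard_topVertices_le [Finite V] (hG : G.IsTree) (r : V) (s : Set V) :
    (G.topVertices r s).ncard ≤ Nat.card (G.induce s).ConnectedComponent := by
  rw [← Nat.card_coe_set_eq]
  refine Nat.card_le_card_of_injective
    (fun v ↦ (G.induce s).connectedComponentMk ⟨v.1, v.2.1⟩) ?_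
  intro v w h
  have h := ConnectedComponent.exact h
  have h1 := hG.dist_eq_of_reachable_topVertices v.2 h
  have h2 := hG.dist_eq_of_reachable_topVertices w.2 h.symm
  refine Subtype.ext ((hG.connected.dist_eq_zero_iff).1 ?_)
  simp only at h1 h2
  omega

/-- If finitely many vertex sets of a rooted tree have a common vertex, then a top vertex of one of
them lies in all of them. -/
lemma IsTree.exists_mem_topVertices [Finite V] (hG : G.IsTree) (r : V) {κ : Type*} {Q : Finset κ}
    (hQ : Q.Nonempty) (s : κ → Set V) (h : (⋂ k ∈ Q, s k).Nonempty) :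
    ∃ i ∈ Q, ∃ v ∈ G.topVertices r (s i), ∀ k ∈ Q, v ∈ s k := by
  obtain ⟨v, hv, hmin⟩ := Set.exists_min_image _ (G.dist r) (Set.toFinite _) h
  simp only [Set.mem_iInter] at hv hmin
  by_contra! hcon
  have hpar : ∀ i ∈ Q, ∃ u ∈ s i, G.Adj u v ∧ G.dist r u < G.dist r v := by
    intro i hi
    by_contra! hi'
    obtain ⟨k, hk, hvk⟩ := hcon i hi v ⟨hv i hi, hi'⟩
    exact hvk (hv k hk)
  obtain ⟨i, hi⟩ := hQ
  obtain ⟨u, -, huv, hu⟩ := hpar i hi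
  refine (hmin u fun k hk ↦ ?_).not_gt hu
  obtain ⟨u', hu's, hu'v, hu'⟩ := hpar k hk
  rwa [hG.eq_of_adj_of_dist_lt huv hu'v hu hu']
end SimpleGraph

open scoped Classical in
lemma sum_sum_prod_le {κ ι X : Type*} [Fintype κ] [Fintype ι] [Fintype X] (F : X → κ → ι → ℝ)
    (hF : ∀ x k a, 0 ≤ F x k a) {Q : Finset κ} {i : κ} (hi : i ∈ Q) {t : ℝ}
    (hQ : ∀ x, ∀ k ∈ Q, k ≠ i → ∑ a, F x k a ≤ 1) (ht : ∀ x, ∀ k ∉ Q, ∑ a, F x k a ≤ t) :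
    ∑ s : κ → ι, ∑ x, ∏ k, F x k (s k) ≤
      (∑ x, ∑ a, F x i a) * t ^ (Fintype.card κ - Q.card) := by
  rw [Finset.sum_comm, Finset.sum_mul]
  refine Finset.sum_le_sum fun x _ ↦ ?_
  have h0 : ∀ k, 0 ≤ ∑ a, F x k a := fun k ↦ Finset.sum_nonneg fun a _ ↦ hF x k a
  have h1 : ∏ k ∈ Q.erase i, ∑ a, F x k a ≤ 1 :=
    Finset.prod_le_one (fun k _ ↦ h0 k) fun k hk ↦
      hQ x k (Finset.mem_of_mem_erase hk) (Finset.ne_of_mem_erase hk)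
  have h2 : ∏ k ∈ Qᶜ, ∑ a, F x k a ≤ t ^ (Fintype.card κ - Q.card) := by
    rw [← Finset.card_compl, ← Finset.prod_const]
    exact Finset.prod_le_prod (fun k _ ↦ h0 k) fun k hk ↦ ht x k (Finset.mem_compl.1 hk)
  calc ∑ s : κ → ι, ∏ k, F x k (s k) = ∏ k, ∑ a, F x k a := by
        rw [Finset.prod_univ_sum, Fintype.piFinset_univ]
    _ = ((∑ a, F x i a) * ∏ k ∈ Q.erase i, ∑ a, F x k a) * ∏ k ∈ Qᶜ, ∑ a, F x k a := by
        rw [Finset.mul_prod_erase Q (fun k ↦ ∑ a, F x k a) hi, Finset.prod_mul_prod_compl]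
    _ ≤ ((∑ a, F x i a) * 1) * t ^ (Fintype.card κ - Q.card) := by
        gcongr
        · exact Finset.prod_nonneg fun k _ ↦ h0 k
        · exact mul_nonneg (h0 i) zero_le_one
        · exact h0 i
    _ = _ := by rw [mul_one]

open scoped Classical in
/-- Weighted count of the families `s : κ → ι` for a fractional matching `f`: a family either
repeats an index, or `q` of its sets meet in a vertex of `R (s i)` for one of these sets. -/
lemma sum_pow_card_le {κ ι V : Type*} [Fintype κ] [Fintype ι] [Fintype V] (A R : ι → Set V)
    {d q : ℕ} (hR : ∀ a, (R a).ncard ≤ d) (hκ : 2 ≤ Fintype.card κ)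
    (f : ι → ℝ) (hf0 : ∀ a, 0 ≤ f a) (hf1 : ∀ a, f a ≤ 1)
    (hload : ∀ v, ∑ a, (if v ∈ A a then f a else 0) ≤ 1)
    (h : ∀ s : κ → ι, s.Injective → ∃ Q : Finset κ, Q.card = q ∧
      ∃ i ∈ Q, ∃ v ∈ R (s i), ∀ k ∈ Q, v ∈ A (s k)) :
    (∑ a, f a) ^ Fintype.card κ ≤
      (Fintype.card κ : ℝ) ^ 2 * (∑ a, f a) ^ (Fintype.card κ - 1) +
      ((Fintype.card κ).choose q) * q * d * (∑ a, f a) ^ (Fintype.card κ - q + 1) := by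
  set t := ∑ a, f a with ht
  have ht0 : 0 ≤ t := Finset.sum_nonneg fun a _ ↦ hf0 a
  let F : κ → κ → ι → κ → ι → ℝ := fun i j x k a ↦
    if k = i ∨ k = j then (if a = x then f a else 0) else f a
  let E : Finset κ → κ → V → κ → ι → ℝ := fun Q i v k a ↦
    if (k = i → v ∈ R a) ∧ (k ∈ Q → k ≠ i → v ∈ A a) then f a else 0
  have hF0 : ∀ i j x k a, 0 ≤ F i j x k a := by
    intro i j x k a
    simp only [F]
    split_ifs <;> simp [hf0]
  have hE0 : ∀ Q i v k a, 0 ≤ E Q i v k a := by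
    intro Q i v k a
    simp only [E]
    split_ifs <;> simp [hf0]
  have hFsum : ∀ ij ∈ (Finset.univ : Finset κ).offDiag,
      ∑ s : κ → ι, ∑ x, ∏ k, F ij.1 ij.2 x k (s k) ≤ t ^ (Fintype.card κ - 1) := by
    rintro ⟨i, j⟩ hij
    have hij : i ≠ j := by simpa using hij
    refine (sum_sum_prod_le (F i j) (hF0 i j) (Q := {i, j}) (i := i) (t := t) (by simp)
      ?_ ?_).trans ?_
    · intro x k hk hki
      simp_all [F]
    · intro x k hk
      simp_all [F]
    · rw [Finset.card_pair hij]
      simp only [F, true_or, if_true, Finset.sum_ite_eq', Finset.mem_univ]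
      rw [← ht, ← pow_succ', show Fintype.card κ - 2 + 1 = Fintype.card κ - 1 by omega]
  have hEsum : ∀ Q ∈ (Finset.univ : Finset κ).powersetCard q, ∀ i ∈ Q,
      ∑ s : κ → ι, ∑ v, ∏ k, E Q i v k (s k) ≤ d * t ^ (Fintype.card κ - q + 1) := by
    intro Q hQ i hi
    have hQc := (Finset.mem_powersetCard.1 hQ).2
    refine (sum_sum_prod_le (E Q i) (hE0 Q i) hi (t := t) ?_ ?_).trans ?_
    · intro v k hk hki
      simpa [E, hk, hki] using hload v
    · intro v k hk
      have hki : k ≠ i := fun h ↦ hk (h ▸ hi)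
      simp [E, hk, hki, ht]
    · rw [hQc, pow_succ', ← mul_assoc]
      gcongr
      rw [Finset.sum_comm, ht, Finset.mul_sum]
      refine Finset.sum_le_sum fun a _ ↦ ?_
      simp only [E, ne_eq, not_true_eq_false, false_imp_iff, imp_true_iff, and_true,
        forall_const]
      rw [← Finset.sum_filter, Finset.sum_const, nsmul_eq_mul]
      refine mul_le_mul_of_nonneg_right ?_ (hf0 a)
      have := hR a
      rw [Set.ncard_eq_toFinset_card'] at this
      rw [Set.filter_mem_univ_eq_toFinset]
      exact_mod_cast this
  have hpt : ∀ s : κ → ι, ∏ k, f (s k) ≤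
      ∑ ij ∈ (Finset.univ : Finset κ).offDiag, ∑ x, ∏ k, F ij.1 ij.2 x k (s k) +
      ∑ Q ∈ (Finset.univ : Finset κ).powersetCard q, ∑ i ∈ Q, ∑ v, ∏ k, E Q i v k (s k) := by
    intro s
    have hFn : ∀ ij : κ × κ, 0 ≤ ∑ x, ∏ k, F ij.1 ij.2 x k (s k) := fun ij ↦
      Finset.sum_nonneg fun x _ ↦ Finset.prod_nonneg fun k _ ↦ hF0 _ _ _ _ _
    have hEn : ∀ Q i, 0 ≤ ∑ v, ∏ k, E Q i v k (s k) := fun Q i ↦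
      Finset.sum_nonneg fun x _ ↦ Finset.prod_nonneg fun k _ ↦ hE0 _ _ _ _ _
    by_cases hs : s.Injective
    · obtain ⟨Q, hQ, i, hi, v, hv, hvQ⟩ := h s hs
      refine le_add_of_nonneg_of_le (Finset.sum_nonneg fun ij _ ↦ hFn ij) ?_
      have hQm : Q ∈ (Finset.univ : Finset κ).powersetCard q := by simp [hQ]
      refine le_trans ?_ (Finset.single_le_sum
        (fun Q _ ↦ Finset.sum_nonneg fun i _ ↦ hEn Q i) hQm)
      refine le_trans ?_ (Finset.single_le_sum (fun i _ ↦ hEn Q i) hi)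
      refine le_trans (le_of_eq ?_) (Finset.single_le_sum
        (fun v _ ↦ Finset.prod_nonneg fun k _ ↦ hE0 Q i v k (s k)) (Finset.mem_univ v))
      refine Finset.prod_congr rfl fun k _ ↦ ?_
      simp only [E]
      rw [if_pos ⟨fun hk ↦ hk ▸ hv, fun hk _ ↦ hvQ k hk⟩]
    · obtain ⟨i, j, hsij, hij⟩ := Function.not_injective_iff.1 hs
      refine le_add_of_le_of_nonneg ?_
        (Finset.sum_nonneg fun Q _ ↦ Finset.sum_nonneg fun i _ ↦ hEn Q i)
      have hm : (i, j) ∈ (Finset.univ : Finset κ).offDiag := by simpa using hij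
      refine le_trans ?_ (Finset.single_le_sum (fun ij _ ↦ hFn ij) hm)
      refine le_trans (le_of_eq ?_) (Finset.single_le_sum
        (fun x _ ↦ Finset.prod_nonneg fun k _ ↦ hF0 i j x k (s k)) (Finset.mem_univ (s i)))
      refine Finset.prod_congr rfl fun k _ ↦ ?_
      simp only [F]
      split_ifs with h1 h2
      · rfl
      · rcases h1 with rfl | rfl <;> simp_all
      · rfl
  calc t ^ Fintype.card κ = ∑ s : κ → ι, ∏ k, f (s k) := by
        rw [← Finset.card_univ, ← Finset.prod_const, ht, Finset.prod_univ_sum,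
          Fintype.piFinset_univ]
    _ ≤ _ := Finset.sum_le_sum fun s _ ↦ hpt s
    _ = ∑ ij ∈ (Finset.univ : Finset κ).offDiag, ∑ s : κ → ι, ∑ x, ∏ k, F ij.1 ij.2 x k (s k) +
        ∑ Q ∈ (Finset.univ : Finset κ).powersetCard q, ∑ i ∈ Q,
          ∑ s : κ → ι, ∑ v, ∏ k, E Q i v k (s k) := by
        rw [Finset.sum_add_distrib, Finset.sum_comm]
        congr 1
        rw [Finset.sum_comm]
        exact Finset.sum_congr rfl fun Q _ ↦ Finset.sum_comm
    _ ≤ ∑ ij ∈ (Finset.univ : Finset κ).offDiag, t ^ (Fintype.card κ - 1) +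
        ∑ Q ∈ (Finset.univ : Finset κ).powersetCard q, ∑ i ∈ Q,
          d * t ^ (Fintype.card κ - q + 1) :=
        add_le_add (Finset.sum_le_sum hFsum)
          (Finset.sum_le_sum fun Q hQ ↦ Finset.sum_le_sum fun i hi ↦ hEsum Q hQ i hi)
    _ ≤ _ := by
        refine add_le_add ?_ (le_of_eq ?_)
        · rw [Finset.sum_const, nsmul_eq_mul]
          gcongr
          rw [Finset.offDiag_card, Finset.card_univ, sq]
          exact_mod_cast Nat.sub_le _ _
        · rw [Finset.sum_congr rfl (g := fun _ ↦ (q : ℝ) * (d * t ^ (Fintype.card κ - q + 1)))]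
          · rw [Finset.sum_const, Finset.card_powersetCard, Finset.card_univ, nsmul_eq_mul]
            ring
          · intro Q hQ
            rw [Finset.sum_const, (Finset.mem_powersetCard.1 hQ).2, nsmul_eq_mul]

open scoped Classical in
/-- If no fractional cover has total weight at most `B`, then there is a fractional matching of
total weight `B`. -/
lemma exists_fracMatching {V ι : Type*} [Fintype V] [Nonempty V] [Fintype ι] (A : ι → Set V)
    {B : ℝ} (hB : 0 < B)
    (hno : ¬ ∃ w : V → ℝ, (∀ v, 0 ≤ w v) ∧ (∀ a, 1 ≤ ∑ v, (A a).indicator w v) ∧ ∑ v, w v ≤ B) :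
    ∃ f : ι → ℝ, (∀ a, 0 ≤ f a) ∧ (∀ v, ∑ a, (if v ∈ A a then f a else 0) ≤ 1) ∧
      ∑ a, f a = B := by
  let L : (V → ℝ) →ₗ[ℝ] (ι → ℝ) :=
    Matrix.toLin' (Matrix.of fun a v ↦ if v ∈ A a then (1 : ℝ) else 0)
  have hL : ∀ w a, L w a = ∑ v, (A a).indicator w v := by
    intro w a
    simp [L, Matrix.mulVec, dotProduct, Set.indicator_apply]
  have hdisj : Disjoint (L '' stdSimplex ℝ V) (Set.Ici fun _ : ι ↦ B⁻¹) := by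
    rw [Set.disjoint_left]
    rintro _ ⟨w, hw, rfl⟩ hx
    refine hno ⟨B • w, fun v ↦ mul_nonneg hB.le (hw.1 v), fun a ↦ ?_, ?_⟩
    · have h1 : B⁻¹ ≤ L w a := hx a
      rw [← hL, map_smul, Pi.smul_apply, smul_eq_mul]
      rwa [inv_le_iff_one_le_mul₀' hB] at h1
    · simp [← Finset.mul_sum, hw.2]
  obtain ⟨φ, u, v, hu, huv, hv⟩ := geometric_hahn_banach_compact_closed
    ((convex_stdSimplex ℝ V).linear_image L)
    ((isCompact_stdSimplex ℝ V).image L.continuous_of_finiteDimensional)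
    (convex_Ici _) isClosed_Ici hdisj
  let y : ι → ℝ := fun a ↦ φ (Pi.single a 1)
  have hφ : ∀ x, φ x = ∑ a, x a * y a := by
    intro x
    conv_lhs => rw [pi_eq_sum_univ' x]
    simp [y, map_sum]
  have hy : ∀ a, 0 ≤ y a := by
    intro a
    by_contra! hneg
    have hb : v < φ ((fun _ : ι ↦ B⁻¹)) := hv _ (Set.mem_Ici.2 le_rfl)
    set b := φ (fun _ : ι ↦ B⁻¹)
    have hc : 0 ≤ (b - v) / (-y a) := div_nonneg (by linarith) (by linarith)
    have := hv ((fun _ : ι ↦ B⁻¹) + ((b - v) / (-y a)) • Pi.single a 1) (by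
      rw [Set.mem_Ici]
      refine le_add_of_nonneg_right (smul_nonneg hc ?_)
      exact Pi.single_nonneg.2 zero_le_one)
    rw [map_add, map_smul, smul_eq_mul] at this
    have h2 : (b - v) / (-y a) * φ (Pi.single a 1) = -(b - v) := by
      change (b - v) / (-y a) * y a = _
      field_simp [hneg.ne]
    rw [h2] at this
    change v < b + _ at this
    linarith
  have hload : ∀ x, ∑ a, (if x ∈ A a then y a else 0) < (∑ a, y a) * B⁻¹ := by
    intro x
    have h1 := hu (L (Pi.single x 1)) ⟨_, single_mem_stdSimplex ℝ x, rfl⟩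
    have h2 := hv _ (Set.mem_Ici.2 (le_refl (fun _ : ι ↦ B⁻¹)))
    rw [hφ] at h1 h2
    rw [← Finset.mul_sum] at h2
    have h3 : ∀ a, L (Pi.single x 1) a * y a = if x ∈ A a then y a else 0 := by
      intro a
      rw [hL, Finset.sum_eq_single x]
      · simp [Set.indicator_apply]
      · intro z _ hz
        simp [Set.indicator_apply, hz]
      · simp
    simp only [h3] at h1
    linarith
  have hpos : 0 < ∑ a, y a := by
    obtain ⟨x⟩ := ‹Nonempty V›
    have h0 : 0 ≤ ∑ a, (if x ∈ A a then y a else 0) :=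
      Finset.sum_nonneg fun a _ ↦ by split_ifs <;> simp [hy]
    exact pos_of_mul_pos_left (h0.trans_lt (hload x)) (inv_nonneg.2 hB.le)
  refine ⟨fun a ↦ B / (∑ a, y a) * y a, fun a ↦ mul_nonneg (by positivity) (hy a), fun x ↦ ?_, ?_⟩
  · have h1 := (hload x).le
    calc ∑ a, (if x ∈ A a then B / (∑ a, y a) * y a else 0)
        = B / (∑ a, y a) * ∑ a, (if x ∈ A a then y a else 0) := by
          simp [Finset.mul_sum]
      _ ≤ B / (∑ a, y a) * ((∑ a, y a) * B⁻¹) := by gcongr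
      _ = 1 := by field_simp
  · rw [← Finset.mul_sum]
    field_simp

lemma vertexFracCoverNum_le {V : Type*} [Fintype V] {H : Finset (Set V)} {w : V → ℝ}
    (h0 : ∀ v, 0 ≤ w v) (h1 : ∀ h ∈ H, 1 ≤ ∑ v, Set.indicator h w v) :
    vertexFracCoverNum H ≤ ∑ v, w v := by
  refine csInf_le ⟨0, ?_⟩ ⟨w, h0, h1, rfl⟩
  rintro _ ⟨w, hw, -, rfl⟩
  exact Finset.sum_nonneg fun v _ ↦ hw v

lemma choose_le_exp_mul_div_pow (p : ℕ) {q : ℕ} (hq : 0 < q) :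
    (p.choose q : ℝ) ≤ (Real.exp 1 * p / q) ^ q := by
  have h1 : (p.choose q : ℝ) ≤ p ^ q / q.factorial := Nat.choose_le_pow_div q p
  have h2 : (q : ℝ) ^ q / q.factorial ≤ Real.exp q :=
    Real.pow_div_factorial_le_exp _ (Nat.cast_nonneg q) q
  have hq' : (0 : ℝ) < q := by exact_mod_cast hq
  have hf : (0 : ℝ) < q.factorial := by exact_mod_cast q.factorial_pos
  refine h1.trans ?_
  rw [div_pow, mul_pow, ← Real.exp_nat_mul, mul_one, div_le_div_iff₀ hf (by positivity)]
  rw [div_le_iff₀ hf] at h2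
  calc (p : ℝ) ^ q * q ^ q ≤ p ^ q * (Real.exp q * q.factorial) := by gcongr
    _ = _ := by ring

lemma rpow_bound_pow_eq {p q d : ℕ} (hq : 2 ≤ q) :
    ((2 : ℝ) ^ (1 / ((q : ℝ) - 1)) * (Real.exp 1 * p) ^ ((q : ℝ) / ((q : ℝ) - 1)) / q
        * (d : ℝ) ^ (1 / ((q : ℝ) - 1))) ^ (q - 1) =
      2 * (Real.exp 1 * p / q) ^ q * q * d := by
  have hq1 : (q : ℝ) - 1 ≠ 0 := by
    have : (2 : ℝ) ≤ q := by exact_mod_cast hq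
    linarith
  have hc : ((q - 1 : ℕ) : ℝ) = (q : ℝ) - 1 := by rw [Nat.cast_sub (by omega), Nat.cast_one]
  have key : ∀ x y : ℝ, 0 ≤ x → (x ^ (y / ((q : ℝ) - 1))) ^ (q - 1) = x ^ y := by
    intro x y hx
    rw [← Real.rpow_natCast, ← Real.rpow_mul hx, hc, div_mul_cancel₀ _ hq1]
  have hep : 0 ≤ Real.exp 1 * p := by positivity
  rw [mul_pow, div_pow, mul_pow, key _ _ (by norm_num), key _ _ hep, key _ _ (Nat.cast_nonneg d),
    Real.rpow_one, Real.rpow_one, Real.rpow_natCast, div_pow]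
  have hq0 : (q : ℝ) ≠ 0 := by positivity
  have : (q : ℝ) ^ q = q ^ (q - 1) * q := by rw [← pow_succ]; congr 1; omega
  rw [this]
  field_simp


theorem tree_fracCover_of_pq_property {V : Type*} [Fintype V]
    (G : SimpleGraph V) (hG : G.IsTree)
    (p q d : ℕ) (hq : 2 ≤ q) (hqp : q ≤ p) (hd : 1 ≤ d)
    (H : Finset (Set V)) (hne : ∀ h ∈ H, h.Nonempty)
    (hcomp : ∀ h ∈ H, Nat.card (G.induce h).ConnectedComponent ≤ d)
    (hcard : p ≤ H.card)
    (hprop : VertexPQProperty H p q) :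
    vertexFracCoverNum H ≤ max
      ((2 : ℝ) ^ (1 / ((q : ℝ) - 1)) * (Real.exp 1 * p) ^ ((q : ℝ) / ((q : ℝ) - 1)) / q
        * (d : ℝ) ^ (1 / ((q : ℝ) - 1)) + 1)
      (2 * (p : ℝ) ^ 2) := by
  set M : ℝ := (2 : ℝ) ^ (1 / ((q : ℝ) - 1)) * (Real.exp 1 * p) ^ ((q : ℝ) / ((q : ℝ) - 1)) / q
        * (d : ℝ) ^ (1 / ((q : ℝ) - 1)) with hM
  set B : ℝ := max (M + 1) (2 * (p : ℝ) ^ 2) with hB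
  have hM0 : 0 ≤ M := by positivity
  have hMB : M < B := (lt_add_one M).trans_le (le_max_left _ _)
  have hB0 : 0 < B := hM0.trans_lt hMB
  classical
  by_contra! hlt
  have : Nonempty V := hG.connected.nonempty
  obtain ⟨r⟩ := this
  have : Nonempty V := ⟨r⟩
  obtain ⟨f, hf0, hload, hsum⟩ := exists_fracMatching (fun a : H ↦ (a : Set V)) hB0 <| by
    rintro ⟨w, hw0, hw1, hwB⟩
    exact hlt.not_ge ((vertexFracCoverNum_le hw0 fun h hh ↦ hw1 ⟨h, hh⟩).trans hwB)
  have hf1 : ∀ a, f a ≤ 1 := by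
    intro a
    obtain ⟨v, hv⟩ := hne a a.2
    refine le_trans (le_of_eq (if_pos hv).symm) ((Finset.single_le_sum
      (f := fun a : H ↦ if v ∈ (a : Set V) then f a else 0) (fun b _ ↦ ?_)
      (Finset.mem_univ a)).trans (hload v))
    split_ifs <;> simp [hf0]
  have hcount := sum_pow_card_le (κ := Fin p) (q := q) (fun a : H ↦ (a : Set V))
    (fun a ↦ G.topVertices r a)
    (fun a ↦ (hG.ncard_topVertices_le r a).trans (hcomp a a.2))
    (by simpa using hq.trans hqp) f hf0 hf1 hload <| by
      intro s hs
      have hinj : Function.Injective fun k ↦ (s k : Set V) := Subtype.val_injective.comp hs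
      obtain ⟨T, hTS, hTq, hT⟩ := hprop (Finset.univ.image fun k ↦ (s k : Set V))
        (by simp [Finset.image_subset_iff])
        (by rw [Finset.card_image_of_injective _ hinj, Finset.card_fin])
      obtain ⟨Q, -, rfl⟩ := Finset.subset_image_iff.1 hTS
      rw [Finset.card_image_of_injective _ hinj] at hTq
      refine ⟨Q, hTq, hG.exists_mem_topVertices r (Finset.card_pos.1 (by omega)) _ ?_⟩
      simpa using hT
  rw [hsum, Fintype.card_fin] at hcount
  have hhalf : (p : ℝ) ^ 2 * B ^ (p - 1) ≤ B ^ p / 2 := by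
    have h1 : (p : ℝ) ^ 2 ≤ B / 2 := by
      have : 2 * (p : ℝ) ^ 2 ≤ B := le_max_right _ _
      linarith
    calc (p : ℝ) ^ 2 * B ^ (p - 1) ≤ B / 2 * B ^ (p - 1) := by gcongr
      _ = B ^ (p - 1 + 1) / 2 := by ring
      _ = B ^ p / 2 := by rw [Nat.sub_add_cancel (by omega)]
  have hsplit : B ^ p = B ^ (q - 1) * B ^ (p - q + 1) := by
    rw [← pow_add]
    congr 1
    omega
  have hle : B ^ (q - 1) ≤ 2 * (p.choose q) * q * d := by
    refine le_of_mul_le_mul_right ?_ (pow_pos hB0 (p - q + 1))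
    rw [← hsplit]
    linarith
  have hchoose : (2 * (p.choose q) * q * d : ℝ) ≤ M ^ (q - 1) := by
    rw [hM, rpow_bound_pow_eq hq]
    have := choose_le_exp_mul_div_pow p (show 0 < q by omega)
    gcongr
  exact (pow_lt_pow_left₀ hMB hM0 (by omega)).not_ge (hle.trans hchoose)
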